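/- arXiv:2408.12019 — 2 statements merged into one kernel-verified Lean document; each statement's English description precedes it below -/
import Mathlib

section
/- Let p be a prime and 2 ≤ ℓ ≤ k with ℓ ≤ n and k ≤ (p^n−1)/(p−1). Then Γ_n^{(k,ℓ)} = Ind_p^{pro}(n,k,ℓ). -/
open Finset

/-- Two vectors `u, v ∈ ℚ_p^n` are (ultrametrically) orthogonal if every linear
combination realizes the equality case of the ultrametric inequality
(here `ℚ_p^n` carries the sup norm). -/
def Orth2 (p : ℕ) [Fact p.Prime] {n : ℕ} (u v : Fin n → ℚ_[p]) : Prop :=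
  ∀ a b : ℚ_[p], ‖a • u + b • v‖ = max ‖a • u‖ ‖b • v‖

/-- A finite set of vectors is weakly orthogonal if any two distinct vectors in it
are orthogonal. -/
def WeaklyOrthSet (p : ℕ) [Fact p.Prime] {n : ℕ} (S : Finset (Fin n → ℚ_[p])) : Prop :=
  ∀ u ∈ S, ∀ v ∈ S, u ≠ v → Orth2 p u v

/-- A finite set `S ⊆ ℚ_p^n \ {0}` is `(k,ℓ)`-weakly orthogonal if every `E ⊆ S` of
size `k` contains a weakly orthogonal subset of size `ℓ`. -/
def WeaklyOrthKL (p : ℕ) [Fact p.Prime] {n : ℕ} (k ℓ : ℕ)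
    (S : Finset (Fin n → ℚ_[p])) : Prop :=
  (0 : Fin n → ℚ_[p]) ∉ S ∧
    ∀ E ⊆ S, E.card = k → ∃ F ⊆ E, F.card = ℓ ∧ WeaklyOrthSet p F

/-- `Δ_n^{(k,ℓ)}`: the maximum size of a finite `(k,ℓ)`-weakly orthogonal subset of
`ℚ_p^n \ {0}`. -/
noncomputable def Delta (p : ℕ) [Fact p.Prime] (n k ℓ : ℕ) : ℕ :=
  sSup {m | ∃ S : Finset (Fin n → ℚ_[p]), WeaklyOrthKL p k ℓ S ∧ S.card = m}

/-- A finite set of nonzero vectors of `ℚ_p^n` is orthogonal if every linear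
combination of its elements realizes the equality case of the ultrametric
inequality (here `ℚ_p^n` carries the sup norm, and we compare nonnegative-real
valued norms so that the empty supremum makes sense). -/
def OrthSet (p : ℕ) [Fact p.Prime] {n : ℕ} (F : Finset (Fin n → ℚ_[p])) : Prop :=
  ∀ lam : (Fin n → ℚ_[p]) → ℚ_[p],
    ‖∑ u ∈ F, lam u • u‖₊ = F.sup fun u => ‖lam u • u‖₊

/-- A finite set `S ⊆ ℚ_p^n \ {0}` is `(k,ℓ)`-orthogonal if every `E ⊆ S` of size
`k` contains an orthogonal subset of size `ℓ`. -/
def OrthKL (p : ℕ) [Fact p.Prime] {n : ℕ} (k ℓ : ℕ)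
    (S : Finset (Fin n → ℚ_[p])) : Prop :=
  (0 : Fin n → ℚ_[p]) ∉ S ∧
    ∀ E ⊆ S, E.card = k → ∃ F ⊆ E, F.card = ℓ ∧ OrthSet p F

/-- `Θ_n^{(k,ℓ)}`: the maximum size of a finite `(k,ℓ)`-orthogonal subset of
`ℚ_p^n \ {0}`. -/
noncomputable def Theta (p : ℕ) [Fact p.Prime] (n k ℓ : ℕ) : ℕ :=
  sSup {m | ∃ S : Finset (Fin n → ℚ_[p]), OrthKL p k ℓ S ∧ S.card = m}
/-- A finite set `S` of points of the projective space `ℙ^{n-1}(F)` is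
`(k,ℓ)`-pro-independent if every subset `X ⊆ S` of size `k` spans (as the span of
representative lines) a subspace of dimension at least `ℓ`. -/
def ProIndKL (F : Type*) [Field F] (n k ℓ : ℕ)
    (S : Finset (Projectivization F (Fin n → F))) : Prop :=
  ∀ X ⊆ S, X.card = k →
    ℓ ≤ Module.finrank F ↥(X.sup fun x => Projectivization.submodule x)

/-- `Ind_q^{pro}(n,k,ℓ)`: the maximum size of a `(k,ℓ)`-pro-independent subset of
`ℙ^{n-1}(F)`, where `F` is a field (with `q` elements). -/
noncomputable def ProIndMax (F : Type*) [Field F] (n k ℓ : ℕ) : ℕ :=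
  sSup {m | ∃ S : Finset (Projectivization F (Fin n → F)),
    ProIndKL F n k ℓ S ∧ S.card = m}

/-- A finite set `S ⊆ ℚ_p^n \ {0}` is `(k,ℓ)`-strongly orthogonal if it is weakly
orthogonal and every `E ⊆ S` of size `k` contains an orthogonal subset of size `ℓ`. -/
def StrongOrthKL (p : ℕ) [Fact p.Prime] {n : ℕ} (k ℓ : ℕ)
    (S : Finset (Fin n → ℚ_[p])) : Prop :=
  (0 : Fin n → ℚ_[p]) ∉ S ∧ WeaklyOrthSet p S ∧
    ∀ E ⊆ S, E.card = k → ∃ F ⊆ E, F.card = ℓ ∧ OrthSet p F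

/-- `Γ_n^{(k,ℓ)}`: the maximum size of a finite `(k,ℓ)`-strongly orthogonal subset
of `ℚ_p^n \ {0}`. -/
noncomputable def Gamma (p : ℕ) [Fact p.Prime] (n k ℓ : ℕ) : ℕ :=
  sSup {m | ∃ S : Finset (Fin n → ℚ_[p]), StrongOrthKL p k ℓ S ∧ S.card = m}

/-- The vector `r` over `𝔽_p` is a reduction modulo `p` of the vector `v` over `ℚ_p` if some
nonzero multiple of `v` has coordinates in `ℤ_p` reducing to those of `r`. -/
def IsReduction (p : ℕ) [Fact p.Prime] {n : ℕ} (v : Fin n → ℚ_[p]) (r : Fin n → ZMod p) : Prop :=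
  ∃ c : ℚ_[p], c ≠ 0 ∧ ∃ W : Fin n → ℤ_[p],
    v = c • (fun j => (W j : ℚ_[p])) ∧ (fun j => PadicInt.toZMod (W j)) = r

theorem toZMod_eq_zero_iff_norm_lt_one {p : ℕ} [Fact p.Prime] (x : ℤ_[p]) :
    PadicInt.toZMod x = 0 ↔ ‖x‖ < 1 := by
  rw [← RingHom.mem_ker, PadicInt.ker_toZMod, IsLocalRing.mem_maximalIdeal, PadicInt.mem_nonunits]

theorem norm_coe_le_one {p : ℕ} [Fact p.Prime] {n : ℕ} (W : Fin n → ℤ_[p]) :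
    ‖fun j => (W j : ℚ_[p])‖ ≤ 1 :=
  (pi_norm_le_iff_of_nonneg zero_le_one).2 fun j => (W j).2

theorem norm_coe_lt_one_iff {p : ℕ} [Fact p.Prime] {n : ℕ} (W : Fin n → ℤ_[p]) :
    ‖fun j => (W j : ℚ_[p])‖ < 1 ↔ (fun j => PadicInt.toZMod (W j)) = 0 := by
  rw [pi_norm_lt_iff zero_lt_one, funext_iff]
  exact forall_congr' fun j => (toZMod_eq_zero_iff_norm_lt_one (W j)).symm

theorem norm_coe_eq_one {p : ℕ} [Fact p.Prime] {n : ℕ} {W : Fin n → ℤ_[p]}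
    (h : (fun j => PadicInt.toZMod (W j)) ≠ 0) : ‖fun j => (W j : ℚ_[p])‖ = 1 :=
  le_antisymm (norm_coe_le_one W) (not_lt.1 (mt (norm_coe_lt_one_iff W).1 h))

theorem exists_isReduction_rep {p : ℕ} [Fact p.Prime] {n : ℕ} {v : Fin n → ℚ_[p]} (hv : v ≠ 0) :
    ∃ x : Projectivization (ZMod p) (Fin n → ZMod p), IsReduction p v x.rep := by
  obtain ⟨i, hi⟩ := Function.ne_iff.1 hv
  have : Nonempty (Fin n) := ⟨i⟩
  obtain ⟨j, hj⟩ := Finite.exists_max fun j => ‖v j‖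
  have hvj : v j ≠ 0 := fun h => hi (norm_le_zero_iff.1 (by simpa [h] using hj i))
  let W : Fin n → ℤ_[p] := fun i => ⟨v i / v j, by
    rw [norm_div]; exact div_le_one_of_le₀ (hj i) (norm_nonneg _)⟩
  have hW : v = v j • fun i => (W i : ℚ_[p]) := by
    ext i
    simp [W, mul_div_cancel₀ _ hvj]
  have hr : (fun i => PadicInt.toZMod (W i)) ≠ 0 := by
    intro h
    have h1 : W j = 1 := Subtype.ext (div_self hvj)
    simpa [h1] using congrFun h j
  obtain ⟨a, ha⟩ := Projectivization.exists_smul_eq_mk_rep (ZMod p) _ hr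
  obtain ⟨A, hA⟩ := ZMod.ringHom_surjective (PadicInt.toZMod (p := p)) (a : ZMod p)
  have hA0 : (A : ℚ_[p]) ≠ 0 := by
    intro h
    have : A = 0 := Subtype.ext h
    rw [this, map_zero] at hA
    exact a.ne_zero hA.symm
  refine ⟨Projectivization.mk (ZMod p) _ hr, v j / A, div_ne_zero hvj hA0, A • W, ?_, ?_⟩
  · conv_lhs => rw [hW]
    ext i
    simp only [Pi.smul_apply, smul_eq_mul, PadicInt.coe_mul]
    field_simp
  · rw [← ha]
    ext i
    simp [hA, Units.smul_def]

/-- A family of vectors over `ℚ_p` with nonzero reductions is orthogonal if and only if the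
reductions are linearly independent. -/
theorem norm_sum_eq_sup_iff_linearIndepOn {p : ℕ} [Fact p.Prime] {n : ℕ} {ι : Type*}
    {s : Finset ι} {f : ι → Fin n → ℚ_[p]} {r : ι → Fin n → ZMod p}
    (hr : ∀ i ∈ s, r i ≠ 0) (hf : ∀ i ∈ s, IsReduction p (f i) (r i)) :
    (∀ lam : ι → ℚ_[p], ‖∑ i ∈ s, lam i • f i‖₊ = s.sup fun i => ‖lam i • f i‖₊) ↔
      LinearIndepOn (ZMod p) r (s : Set ι) := by
  classical
  choose! c hc W hW hWr using hf
  have hred (A : ι → ℤ_[p]) :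
      (fun j => PadicInt.toZMod ((∑ i ∈ s, A i • W i) j)) =
        ∑ i ∈ s, PadicInt.toZMod (A i) • r i := by
    ext j
    simp only [Finset.sum_apply, Pi.smul_apply, smul_eq_mul, map_sum, map_mul]
    exact Finset.sum_congr rfl fun i hi => by rw [← hWr i hi]
  have hcoe (A : ι → ℤ_[p]) :
      (fun j => (((∑ i ∈ s, A i • W i) j : ℤ_[p]) : ℚ_[p])) =
        ∑ i ∈ s, (A i : ℚ_[p]) • fun j => (W i j : ℚ_[p]) := by
    ext j
    simp [Finset.sum_apply]
  have hnorm : ∀ i ∈ s, ‖fun j => (W i j : ℚ_[p])‖ = 1 := fun i hi =>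
    norm_coe_eq_one (by rw [hWr i hi]; exact hr i hi)
  rw [linearIndepOn_finset_iff]
  constructor
  · intro h g hg i hi
    choose A hA using fun i => ZMod.ringHom_surjective (PadicInt.toZMod (p := p)) (g i)
    have hlt : ‖fun j => (((∑ i ∈ s, A i • W i) j : ℤ_[p]) : ℚ_[p])‖ < 1 := by
      rw [norm_coe_lt_one_iff, hred]
      simpa only [hA] using hg
    have hterm : ∀ i ∈ s, ((A i : ℚ_[p]) / c i) • f i =
        (A i : ℚ_[p]) • fun j => (W i j : ℚ_[p]) := by
      intro i hi
      conv_lhs => rw [hW i hi, smul_smul, div_mul_cancel₀ _ (hc i hi)]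
    have h1 := h fun i => (A i : ℚ_[p]) / c i
    rw [Finset.sum_congr rfl hterm, ← hcoe] at h1
    have h2 : ‖((A i : ℚ_[p]) / c i) • f i‖₊ < 1 :=
      (Finset.le_sup (f := fun i => ‖((A i : ℚ_[p]) / c i) • f i‖₊) hi).trans_lt
        (h1 ▸ (by exact_mod_cast hlt))
    rw [hterm i hi] at h2
    have h3 : ‖(A i : ℚ_[p]) • fun j => (W i j : ℚ_[p])‖ < 1 := by exact_mod_cast h2
    rw [norm_smul, hnorm i hi, mul_one] at h3
    rw [← hA, toZMod_eq_zero_iff_norm_lt_one]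
    exact h3
  · intro h lam
    rcases s.eq_empty_or_nonempty with rfl | hs
    · simp
    have hterm : ∀ i ∈ s, lam i • f i = (lam i * c i) • fun j => (W i j : ℚ_[p]) := by
      intro i hi
      conv_lhs => rw [hW i hi, smul_smul]
    have hterm' : ∀ i ∈ s, ‖lam i • f i‖₊ = ‖lam i * c i‖₊ := by
      intro i hi
      have := hnorm i hi
      ext
      rw [coe_nnnorm, coe_nnnorm, hterm i hi, norm_smul, this, mul_one]
    rw [Finset.sum_congr rfl hterm, Finset.sup_congr rfl hterm']
    obtain ⟨m, hm, hmax⟩ := s.exists_max_image (fun i => ‖lam i * c i‖₊) hs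
    have hsup : (s.sup fun i => ‖lam i * c i‖₊) = ‖lam m * c m‖₊ :=
      le_antisymm (Finset.sup_le hmax) (Finset.le_sup (f := fun i => ‖lam i * c i‖₊) hm)
    rw [hsup]
    by_cases h0 : lam m * c m = 0
    · have hz : ∀ i ∈ s, lam i * c i = 0 := fun i hi => by
        simpa [h0] using hmax i hi
      rw [h0, nnnorm_zero, nnnorm_eq_zero]
      exact Finset.sum_eq_zero fun i hi => by rw [hz i hi, zero_smul]
    let A : ι → ℤ_[p] := fun i => if hi : i ∈ s then ⟨lam i * c i / (lam m * c m), by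
      rw [norm_div]; exact div_le_one_of_le₀ (hmax i hi) (norm_nonneg _)⟩ else 0
    have hA : ∀ i ∈ s, (A i : ℚ_[p]) = lam i * c i / (lam m * c m) := fun i hi => by
      simp [A, hi]
    have hAm : A m = 1 := Subtype.ext (by rw [hA m hm, div_self h0]; rfl)
    have hsum : ∑ i ∈ s, (lam i * c i) • (fun j => (W i j : ℚ_[p])) =
        (lam m * c m) • fun j => (((∑ i ∈ s, A i • W i) j : ℤ_[p]) : ℚ_[p]) := by
      rw [hcoe, Finset.smul_sum]
      refine Finset.sum_congr rfl fun i hi => ?_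
      rw [smul_smul, hA i hi, mul_div_cancel₀ _ h0]
    have hone : ‖fun j => (((∑ i ∈ s, A i • W i) j : ℤ_[p]) : ℚ_[p])‖ = 1 := by
      apply norm_coe_eq_one
      rw [hred]
      intro hz
      simpa [hAm] using h (fun i => PadicInt.toZMod (A i)) hz m hm
    ext
    rw [hsum, coe_nnnorm, coe_nnnorm, norm_smul, hone, mul_one]

theorem orthSet_image_iff {p : ℕ} [Fact p.Prime] {n : ℕ} {ι : Type*} {s : Finset ι}
    {f : ι → Fin n → ℚ_[p]} (hf : Set.InjOn f s) [DecidableEq (Fin n → ℚ_[p])] :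
    OrthSet p (s.image f) ↔
      ∀ lam : ι → ℚ_[p], ‖∑ i ∈ s, lam i • f i‖₊ = s.sup fun i => ‖lam i • f i‖₊ := by
  rcases s.eq_empty_or_nonempty with rfl | ⟨i₀, -⟩
  · simp [OrthSet]
  have : Nonempty ι := ⟨i₀⟩
  unfold OrthSet
  constructor
  · intro h lam
    have hinv : ∀ i ∈ s, lam (Function.invFunOn f s (f i)) = lam i := fun i hi => by
      rw [hf.leftInvOn_invFunOn hi]
    have := h fun v => lam (Function.invFunOn f s v)
    rw [Finset.sum_image hf, Finset.sup_image] at this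
    rw [Finset.sum_congr rfl fun i hi => by rw [← hinv i hi], this]
    exact Finset.sup_congr rfl fun i hi => by simp only [Function.comp_apply, hinv i hi]
  · intro h lam
    rw [Finset.sum_image hf, Finset.sup_image]
    exact h fun i => lam (f i)

theorem orthSet_image_iff_linearIndepOn {p : ℕ} [Fact p.Prime] {n : ℕ} {ι : Type*}
    {s : Finset ι} {f : ι → Fin n → ℚ_[p]} (hinj : Set.InjOn f s)
    [DecidableEq (Fin n → ℚ_[p])] {r : ι → Fin n → ZMod p}
    (hr : ∀ i ∈ s, r i ≠ 0) (hf : ∀ i ∈ s, IsReduction p (f i) (r i)) :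
    OrthSet p (s.image f) ↔ LinearIndepOn (ZMod p) r (s : Set ι) :=
  (orthSet_image_iff hinj).trans (norm_sum_eq_sup_iff_linearIndepOn hr hf)

theorem orth2_iff_orthSet_pair {p : ℕ} [Fact p.Prime] {n : ℕ} {u v : Fin n → ℚ_[p]}
    (huv : u ≠ v) [DecidableEq (Fin n → ℚ_[p])] : Orth2 p u v ↔ OrthSet p {u, v} := by
  unfold Orth2 OrthSet
  simp only [Finset.sum_pair huv, Finset.sup_insert, Finset.sup_singleton]
  constructor
  · intro h lam
    ext
    rw [NNReal.coe_max]
    exact h (lam u) (lam v)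
  · intro h a b
    have := congrArg NNReal.toReal (h fun w => if w = u then a else b)
    simpa [huv.symm] using this

/-- A finite set of points of projective space spans a subspace of dimension at least `ℓ` if and
only if it contains `ℓ` independent points. -/
theorem le_finrank_sup_submodule_iff {K V : Type*} [Field K] [AddCommGroup V] [Module K V]
    (X : Finset (Projectivization K V)) (ℓ : ℕ) :
    ℓ ≤ Module.finrank K ↥(X.sup fun x => Projectivization.submodule x) ↔
      ∃ F ⊆ X, F.card = ℓ ∧ LinearIndepOn K Projectivization.rep (F : Set (Projectivization K V)) := by
  classical
  have hspan : (X.sup fun x => Projectivization.submodule x) =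
      Submodule.span K (Projectivization.rep '' (X : Set (Projectivization K V))) := by
    rw [Finset.sup_eq_iSup, Set.image_eq_iUnion, Submodule.span_iUnion₂]
    simp [Projectivization.submodule_eq]
  have hfin : Module.Finite K
      (Submodule.span K (Projectivization.rep '' (X : Set (Projectivization K V)))) :=
    Module.Finite.span_of_finite K (X.finite_toSet.image _)
  have hcard {F : Finset (Projectivization K V)}
      (hF : LinearIndepOn K Projectivization.rep (F : Set (Projectivization K V))) :
      Module.finrank K (Submodule.span K
        (Projectivization.rep '' (F : Set (Projectivization K V)))) = F.card := by
    have h := finrank_span_eq_card hF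
    rw [Set.image_eq_range]
    exact h.trans (by simp)
  rw [hspan]
  constructor
  · intro h
    obtain ⟨b, hbX, -, hsub, hb⟩ := exists_linearIndepOn_extension
      (linearIndepOn_empty K (Projectivization.rep (K := K) (V := V)))
      (Set.empty_subset (X : Set (Projectivization K V)))
    lift b to Finset (Projectivization K V) using X.finite_toSet.subset hbX
    have heq : Submodule.span K (Projectivization.rep '' (X : Set (Projectivization K V))) =
        Submodule.span K (Projectivization.rep '' (b : Set (Projectivization K V))) :=
      le_antisymm (Submodule.span_le.2 hsub) (Submodule.span_mono (Set.image_mono hbX))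
    rw [heq, hcard hb] at h
    obtain ⟨F, hFb, hF⟩ := Finset.exists_subset_card_eq h
    exact ⟨F, hFb.trans (by exact_mod_cast hbX), hF, hb.mono (by exact_mod_cast hFb)⟩
  · rintro ⟨F, hFX, rfl, hF⟩
    rw [← hcard hF]
    exact Submodule.finrank_mono (Submodule.span_mono (Set.image_mono (by exact_mod_cast hFX)))

theorem StrongOrthKL.exists_proIndKL {p : ℕ} [Fact p.Prime] {n k ℓ : ℕ} (hn : 0 < n)
    {S : Finset (Fin n → ℚ_[p])} (hS : StrongOrthKL p k ℓ S) :
    ∃ T : Finset (Projectivization (ZMod p) (Fin n → ZMod p)),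
      ProIndKL (ZMod p) n k ℓ T ∧ T.card = S.card := by
  classical
  obtain ⟨h0, hweak, hkl⟩ := hS
  have : Nonempty (Fin n) := ⟨⟨0, hn⟩⟩
  have : Nonempty (Projectivization (ZMod p) (Fin n → ZMod p)) := inferInstance
  choose! x hx using fun (v : Fin n → ℚ_[p]) (hv : v ≠ 0) => exists_isReduction_rep hv
  have hne : ∀ v ∈ S, v ≠ 0 := fun v hv h => h0 (h ▸ hv)
  have key : ∀ F ⊆ S, (OrthSet p F ↔
      LinearIndepOn (ZMod p) (Projectivization.rep ∘ x) (F : Set (Fin n → ℚ_[p]))) := by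
    intro F hF
    simpa using orthSet_image_iff_linearIndepOn (s := F) (f := id)
      (r := Projectivization.rep ∘ x) Function.injective_id.injOn
      (fun i _ => (x i).rep_nonzero) fun i hi => hx i (hne i (hF hi))
  have hinj : Set.InjOn x S := by
    intro u hu v hv huv
    by_contra hne
    have h1 := (orth2_iff_orthSet_pair hne).1 (hweak u hu v hv hne)
    have h2 := (key _ (by simpa [Finset.insert_subset_iff] using ⟨hu, hv⟩)).1 h1
    exact hne (h2.injOn (by simp) (by simp) (congrArg Projectivization.rep huv))
  refine ⟨S.image x, fun X hX hXk => ?_, Finset.card_image_of_injOn hinj⟩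
  obtain ⟨E, hE, rfl⟩ := Finset.subset_image_iff.1 hX
  have hES : E ⊆ S := by exact_mod_cast hE
  rw [Finset.card_image_of_injOn (hinj.mono hE)] at hXk
  obtain ⟨F, hFE, hFl, hF⟩ := hkl E hES hXk
  have hFS := hFE.trans hES
  rw [le_finrank_sup_submodule_iff]
  refine ⟨F.image x, Finset.image_subset_image hFE, ?_, ?_⟩
  · rw [Finset.card_image_of_injOn (hinj.mono (by exact_mod_cast hFS)), hFl]
  · have := (key F hFS).1 hF
    rw [Finset.coe_image]
    exact (linearIndependent_equiv' (Equiv.Set.imageOfInjOn _ _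
      (hinj.mono (by exact_mod_cast hFS))) rfl).1 this

theorem ProIndKL.exists_strongOrthKL {p : ℕ} [Fact p.Prime] {n k ℓ : ℕ}
    {T : Finset (Projectivization (ZMod p) (Fin n → ZMod p))} (hT : ProIndKL (ZMod p) n k ℓ T) :
    ∃ S : Finset (Fin n → ℚ_[p]), StrongOrthKL p k ℓ S ∧ S.card = T.card := by
  classical
  have hsurj := ZMod.ringHom_surjective (PadicInt.toZMod (p := p))
  let W : Projectivization (ZMod p) (Fin n → ZMod p) → Fin n → ℤ_[p] :=
    fun x j => Function.surjInv hsurj (x.rep j)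
  let g : Projectivization (ZMod p) (Fin n → ZMod p) → Fin n → ℚ_[p] := fun x j => W x j
  have hW : ∀ x, (fun j => PadicInt.toZMod (W x j)) = x.rep := fun x =>
    funext fun j => Function.surjInv_eq hsurj _
  have hg : ∀ x, IsReduction p (g x) x.rep := fun x =>
    ⟨1, one_ne_zero, W x, (one_smul _ _).symm, hW x⟩
  have hrep : Function.Injective (Projectivization.rep (K := ZMod p) (V := Fin n → ZMod p)) := by
    intro x y hxy
    rw [← x.mk_rep, ← y.mk_rep]
    simp only [hxy]
  have hinj : Function.Injective g := by
    intro x y hxy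
    have hWxy : W x = W y := funext fun j => Subtype.ext (congrFun hxy j)
    exact hrep (by rw [← hW x, ← hW y, hWxy])
  have key : ∀ F : Finset (Projectivization (ZMod p) (Fin n → ZMod p)), (OrthSet p (F.image g) ↔ LinearIndepOn (ZMod p) Projectivization.rep
      (F : Set (Projectivization (ZMod p) (Fin n → ZMod p)))) := fun F =>
    orthSet_image_iff_linearIndepOn hinj.injOn (fun x _ => x.rep_nonzero) fun x _ => hg x
  refine ⟨T.image g, ⟨?_, ?_, ?_⟩, Finset.card_image_of_injective _ hinj⟩
  · intro h
    obtain ⟨x, -, hx⟩ := Finset.mem_image.1 h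
    have h1 : ‖g x‖ = 1 := norm_coe_eq_one (by rw [hW]; exact x.rep_nonzero)
    simp [hx] at h1
  · intro u hu v hv huv
    obtain ⟨x, -, rfl⟩ := Finset.mem_image.1 hu
    obtain ⟨y, -, rfl⟩ := Finset.mem_image.1 hv
    have hxy : LinearIndepOn (ZMod p) Projectivization.rep
        (({x, y} : Finset (Projectivization (ZMod p) (Fin n → ZMod p))) :
          Set (Projectivization (ZMod p) (Fin n → ZMod p))) := by
      rw [linearIndepOn_iff_image hrep.injOn, Finset.coe_pair, Set.image_pair]
      exact Projectivization.linearIndepOn_pair x y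
    rw [orth2_iff_orthSet_pair huv, ← Finset.image_singleton, ← Finset.image_insert]
    exact (key _).2 hxy
  · intro E hE hEk
    obtain ⟨X, hX, rfl⟩ := Finset.subset_image_iff.1 hE
    rw [Finset.card_image_of_injective _ hinj] at hEk
    obtain ⟨F, hFX, hFl, hF⟩ :=
      (le_finrank_sup_submodule_iff X ℓ).1 (hT X (by exact_mod_cast hX) hEk)
    exact ⟨F.image g, Finset.image_subset_image hFX,
      by rw [Finset.card_image_of_injective _ hinj, hFl], (key F).2 hF⟩

theorem stmt10 (p : ℕ) [Fact p.Prime] (n k ℓ : ℕ)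
    (hℓ : 2 ≤ ℓ) (hkℓ : ℓ ≤ k) (hℓn : ℓ ≤ n) (hk : k ≤ (p ^ n - 1) / (p - 1)) :
    Gamma p n k ℓ = ProIndMax (ZMod p) n k ℓ := by
  have hn : 0 < n := by omega
  unfold Gamma ProIndMax
  congr 1
  ext m
  constructor
  · rintro ⟨S, hS, rfl⟩
    exact hS.exists_proIndKL hn
  · rintro ⟨T, hT, rfl⟩
    exact hT.exists_strongOrthKL
end

section
/- Let q be a prime power, 𝔽_q a finite field with q elements, and 2 ≤ ℓ ≤ k with ℓ ≤ n and k ≤ (q^{ℓ−1}−1)/(q−1). Then Ind_q(n,k,ℓ) = (q−1) · Ind_q^{pro}(n,k,ℓ) if and only if q = 2. -/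
open Finset

/-- A finite set `S ⊆ F^n \ {0}` is `(k,ℓ)`-independent if every subset `X ⊆ S` of
size `k` spans a subspace of dimension at least `ℓ`. -/
def IndKL (F : Type*) [Field F] (n k ℓ : ℕ) (S : Finset (Fin n → F)) : Prop :=
  (0 : Fin n → F) ∉ S ∧
    ∀ X ⊆ S, X.card = k →
      ℓ ≤ Module.finrank F ↥(Submodule.span F (↑X : Set (Fin n → F)))

/-- `Ind_q(n,k,ℓ)`: the maximum size of a `(k,ℓ)`-independent subset of
`F^n \ {0}`, where `F` is a field (with `q` elements). -/
noncomputable def IndMax (F : Type*) [Field F] (n k ℓ : ℕ) : ℕ :=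
  sSup {m | ∃ S : Finset (Fin n → F), IndKL F n k ℓ S ∧ S.card = m}

open Classical in
/-- The finite set of nonzero vectors whose projective class lies in `T`. -/
noncomputable def projCone {F : Type*} [Field F] [Fintype F] {n : ℕ}
    (T : Finset (Projectivization F (Fin n → F))) : Finset (Fin n → F) :=
  (T ×ˢ (Finset.univ : Finset Fˣ)).image fun x => x.2 • x.1.rep

theorem mem_projCone {F : Type*} [Field F] [Fintype F] {n : ℕ}
    {T : Finset (Projectivization F (Fin n → F))} {v : Fin n → F} :
    v ∈ projCone T ↔ ∃ h : v ≠ 0, Projectivization.mk F v h ∈ T := by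
  classical
  simp only [projCone, Finset.mem_image, Finset.mem_product, Finset.mem_univ, and_true,
    Prod.exists]
  constructor
  · rintro ⟨p, a, hp, rfl⟩
    have h : a • p.rep ≠ 0 := (smul_ne_zero_iff_ne a).2 p.rep_nonzero
    refine ⟨h, ?_⟩
    have : Projectivization.mk F (a • p.rep) h = p := by
      conv_rhs => rw [← p.mk_rep]
      exact (Projectivization.mk_eq_mk_iff F _ _ _ _).2 ⟨a, rfl⟩
    rwa [this]
  · rintro ⟨h, hT⟩
    obtain ⟨a, ha⟩ := Projectivization.exists_smul_eq_mk_rep F v h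
    exact ⟨_, a⁻¹, hT, by rw [← ha, inv_smul_smul]⟩

theorem card_projCone {F : Type*} [Field F] [Fintype F] {n : ℕ}
    (T : Finset (Projectivization F (Fin n → F))) :
    (projCone T).card = (Fintype.card F - 1) * T.card := by
  classical
  rw [projCone, Finset.card_image_of_injective, Finset.card_product, Finset.card_univ,
    Fintype.card_units, mul_comm]
  rintro ⟨p, a⟩ ⟨p', b⟩ h
  simp only at h
  have hp : p = p' := by
    rw [← p.mk_rep, ← p'.mk_rep]
    refine (Projectivization.mk_eq_mk_iff F _ _ _ _).2 ⟨a⁻¹ * b, ?_⟩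
    rw [mul_smul, ← h, inv_smul_smul]
  subst hp
  have hab : (a : F) • p.rep = (b : F) • p.rep := h
  rw [Prod.mk.injEq]
  exact ⟨rfl, Units.ext (smul_left_injective F p.rep_nonzero hab)⟩

theorem span_projCone_le {F : Type*} [Field F] [Fintype F] {n : ℕ}
    (T : Finset (Projectivization F (Fin n → F))) :
    Submodule.span F (projCone T : Set (Fin n → F)) ≤
      T.sup fun x => Projectivization.submodule x := by
  rw [Submodule.span_le]
  intro v hv
  obtain ⟨h, hT⟩ := mem_projCone.1 (Finset.mem_coe.1 hv)
  refine Finset.le_sup (f := fun x => Projectivization.submodule x) hT ?_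
  rw [Projectivization.submodule_mk]
  exact Submodule.mem_span_singleton_self v

open Classical in
/-- The set of projective points represented by a nonzero vector of `S`. -/
noncomputable def projImage {F : Type*} [Field F] [Fintype F] {n : ℕ}
    (S : Finset (Fin n → F)) : Finset (Projectivization F (Fin n → F)) :=
  haveI := Fintype.ofFinite (Projectivization F (Fin n → F))
  Finset.univ.filter fun p => ∃ v ∈ S, ∃ h : v ≠ 0, Projectivization.mk F v h = p

theorem mem_projImage {F : Type*} [Field F] [Fintype F] {n : ℕ}
    {S : Finset (Fin n → F)} {p : Projectivization F (Fin n → F)} :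
    p ∈ projImage S ↔ ∃ v ∈ S, ∃ h : v ≠ 0, Projectivization.mk F v h = p := by
  simp [projImage]

theorem IndKL.subset_projCone {F : Type*} [Field F] [Fintype F] {n k ℓ : ℕ}
    {S : Finset (Fin n → F)} (hS : IndKL F n k ℓ S) : S ⊆ projCone (projImage S) := by
  intro v hv
  have h : v ≠ 0 := fun h => hS.1 (h ▸ hv)
  exact mem_projCone.2 ⟨h, mem_projImage.2 ⟨v, hv, h, rfl⟩⟩

theorem IndKL.proIndKL_projImage {F : Type*} [Field F] [Fintype F] {n k ℓ : ℕ}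
    {S : Finset (Fin n → F)} (hS : IndKL F n k ℓ S) : ProIndKL F n k ℓ (projImage S) := by
  classical
  intro Y hY hYk
  have hrep : ∀ p : Y, ∃ v ∈ S, ∃ h : v ≠ 0, Projectivization.mk F v h = p.1 :=
    fun p => mem_projImage.1 (hY p.2)
  choose f hfS hf0 hf using hrep
  have hinj : Function.Injective f := by
    intro p p' h
    apply Subtype.ext
    rw [← hf p, ← hf p']
    simp only [h]
  have hsub : Y.attach.image f ⊆ projCone Y := by
    intro v hv
    obtain ⟨p, -, rfl⟩ := Finset.mem_image.1 hv
    exact mem_projCone.2 ⟨hf0 p, by rw [hf p]; exact p.2⟩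
  refine (hS.2 (Y.attach.image f) ?_ ?_).trans (Submodule.finrank_mono ?_)
  · intro v hv
    obtain ⟨p, -, rfl⟩ := Finset.mem_image.1 hv
    exact hfS p
  · rw [Finset.card_image_of_injective _ hinj, Finset.card_attach, hYk]
  · exact (Submodule.span_mono (Finset.coe_subset.2 hsub)).trans (span_projCone_le Y)

theorem Projectivization.rep_injective {F V : Type*} [Field F] [AddCommGroup V] [Module F V] :
    Function.Injective (Projectivization.rep : Projectivization F V → V) := by
  intro p p' h
  rw [← p.mk_rep, ← p'.mk_rep]
  simp only [h]

open Classical in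
theorem ProIndKL.indKL_image_rep {F : Type*} [Field F] {n k ℓ : ℕ}
    {T : Finset (Projectivization F (Fin n → F))} (hT : ProIndKL F n k ℓ T) :
    IndKL F n k ℓ (T.image Projectivization.rep) := by
  refine ⟨?_, ?_⟩
  · intro h
    obtain ⟨p, -, hp⟩ := Finset.mem_image.1 h
    exact p.rep_nonzero hp
  · intro X hX hXk
    obtain ⟨Y, hY, rfl⟩ := Finset.subset_image_iff.1 hX
    rw [Finset.card_image_of_injective _ Projectivization.rep_injective] at hXk
    refine (hT Y (by simpa using hY) hXk).trans (Submodule.finrank_mono ?_)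
    refine Finset.sup_le fun p hp => ?_
    rw [Projectivization.submodule_eq]
    refine Submodule.span_mono (Set.singleton_subset_iff.2 ?_)
    exact Finset.mem_coe.2 (Finset.mem_image_of_mem _ hp)

theorem bddAbove_card_finset {α : Type*} [Finite α] (P : Finset α → Prop) :
    BddAbove {m | ∃ S : Finset α, P S ∧ S.card = m} := by
  have := Fintype.ofFinite α
  exact ⟨Fintype.card α, by rintro m ⟨S, -, rfl⟩; exact S.card_le_univ⟩

theorem IndKL.card_le_indMax {F : Type*} [Field F] [Finite F] {n k ℓ : ℕ}
    {S : Finset (Fin n → F)} (hS : IndKL F n k ℓ S) : S.card ≤ IndMax F n k ℓ :=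
  le_csSup (bddAbove_card_finset _) ⟨S, hS, rfl⟩

theorem ProIndKL.card_le_proIndMax {F : Type*} [Field F] [Finite F] {n k ℓ : ℕ}
    {T : Finset (Projectivization F (Fin n → F))} (hT : ProIndKL F n k ℓ T) :
    T.card ≤ ProIndMax F n k ℓ :=
  le_csSup (bddAbove_card_finset _) ⟨T, hT, rfl⟩

theorem exists_indKL_card_eq_indMax (F : Type*) [Field F] [Finite F] {n k : ℕ} (ℓ : ℕ)
    (hk : 0 < k) : ∃ S, IndKL F n k ℓ S ∧ S.card = IndMax F n k ℓ := by
  refine Nat.sSup_mem (s := {m | ∃ S, IndKL F n k ℓ S ∧ S.card = m})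
    ⟨0, ∅, ⟨by simp, fun X hX hXk => ?_⟩, rfl⟩ (bddAbove_card_finset _)
  rw [Finset.subset_empty.1 hX, Finset.card_empty] at hXk
  omega

theorem exists_proIndKL_card_eq_proIndMax (F : Type*) [Field F] [Finite F] {n k : ℕ} (ℓ : ℕ)
    (hk : 0 < k) : ∃ T, ProIndKL F n k ℓ T ∧ T.card = ProIndMax F n k ℓ := by
  refine Nat.sSup_mem (s := {m | ∃ T, ProIndKL F n k ℓ T ∧ T.card = m})
    ⟨0, ∅, fun X hX hXk => ?_, rfl⟩ (bddAbove_card_finset _)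
  rw [Finset.subset_empty.1 hX, Finset.card_empty] at hXk
  omega

theorem proIndMax_le_indMax (F : Type*) [Field F] [Finite F] {n k : ℕ} (ℓ : ℕ) (hk : 0 < k) :
    ProIndMax F n k ℓ ≤ IndMax F n k ℓ := by
  classical
  obtain ⟨T, hT, hTc⟩ := exists_proIndKL_card_eq_proIndMax F (n := n) ℓ hk
  rw [← hTc, ← Finset.card_image_of_injective T Projectivization.rep_injective]
  exact hT.indKL_image_rep.card_le_indMax

theorem IndKL.card_le_mul_card_projImage {F : Type*} [Field F] [Fintype F] {n k ℓ : ℕ}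
    {S : Finset (Fin n → F)} (hS : IndKL F n k ℓ S) :
    S.card ≤ (Fintype.card F - 1) * (projImage S).card :=
  card_projCone (projImage S) ▸ Finset.card_le_card hS.subset_projCone

theorem indMax_le_mul_proIndMax (F : Type*) [Field F] [Fintype F] {n k : ℕ} (ℓ : ℕ)
    (hk : 0 < k) : IndMax F n k ℓ ≤ (Fintype.card F - 1) * ProIndMax F n k ℓ := by
  obtain ⟨S, hS, hSc⟩ := exists_indKL_card_eq_indMax F (n := n) ℓ hk
  rw [← hSc]
  exact hS.card_le_mul_card_projImage.trans
    (Nat.mul_le_mul_left _ hS.proIndKL_projImage.card_le_proIndMax)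

/-- Any subset of a `(k,ℓ)`-independent set with at least `k` elements spans dimension `≥ ℓ`. -/
theorem IndKL.le_finrank {F : Type*} [Field F] {n k ℓ : ℕ} {S X : Finset (Fin n → F)}
    (hS : IndKL F n k ℓ S) (hX : X ⊆ S) (hk : k ≤ X.card) {W : Submodule F (Fin n → F)}
    (hXW : (X : Set (Fin n → F)) ⊆ W) : ℓ ≤ Module.finrank F W := by
  obtain ⟨Y, hY, hYk⟩ := Finset.exists_subset_card_eq hk
  refine (hS.2 Y (hY.trans hX) hYk).trans (Submodule.finrank_mono (Submodule.span_le.2 ?_))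
  exact (Finset.coe_subset.2 hY).trans hXW

/-- If the cone over `T` is `(k,ℓ)`-independent and `q ≥ 3`, any point can be added to `T`. -/
theorem proIndKL_insert_of_indKL_projCone {F : Type*} [Field F] [Fintype F] {n k ℓ : ℕ}
    [DecidableEq (Projectivization F (Fin n → F))]
    (hF : 3 ≤ Fintype.card F) (hk : 2 ≤ k) {T : Finset (Projectivization F (Fin n → F))}
    (hT : IndKL F n k ℓ (projCone T)) (x : Projectivization F (Fin n → F)) :
    ProIndKL F n k ℓ (insert x T) := by
  intro X hX hXk
  have hsub : X.erase x ⊆ T := by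
    intro p hp
    rw [Finset.mem_erase] at hp
    exact (Finset.mem_insert.1 (hX hp.2)).resolve_left hp.1
  have hcone : projCone (X.erase x) ⊆ projCone T := fun v hv => by
    obtain ⟨h, hv⟩ := mem_projCone.1 hv
    exact mem_projCone.2 ⟨h, hsub hv⟩
  refine hT.le_finrank hcone ?_ (Submodule.subset_span.trans
    ((span_projCone_le _).trans (Finset.sup_mono (X.erase_subset x))))
  rw [card_projCone]
  have h1 : k - 1 ≤ (X.erase x).card := hXk ▸ Finset.pred_card_le_card_erase
  have h2 : 2 * (k - 1) ≤ (Fintype.card F - 1) * (X.erase x).card :=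
    Nat.mul_le_mul (by omega) h1
  omega

/-- The set of all nonzero vectors is not `(k,ℓ)`-independent when `k ≤ q ^ (ℓ - 1) - 1`. -/
theorem IndKL.exists_ne_zero_notMem {F : Type*} [Field F] [Fintype F] {n k ℓ : ℕ}
    {S : Finset (Fin n → F)} (hS : IndKL F n k ℓ S) (hℓ : 1 ≤ ℓ) (hℓn : ℓ ≤ n)
    (hk : k ≤ Fintype.card F ^ (ℓ - 1) - 1) : ∃ v, v ≠ 0 ∧ v ∉ S := by
  classical
  by_contra! hall
  have hli : LinearIndependent F (Pi.basisFun F (Fin n) ∘ Fin.castLE (by omega : ℓ - 1 ≤ n)) :=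
    (Pi.basisFun F (Fin n)).linearIndependent.comp _ (Fin.castLE_injective _)
  obtain ⟨W, hW⟩ : ∃ W : Submodule F (Fin n → F), Module.finrank F W = ℓ - 1 :=
    ⟨_, (finrank_span_eq_card hli).trans (Fintype.card_fin _)⟩
  have hcard : ((Finset.univ.filter fun v : Fin n → F => v ∈ W).erase 0).card =
      Fintype.card F ^ (ℓ - 1) - 1 := by
    rw [Finset.card_erase_of_mem (by simp), ← Fintype.card_subtype, ← hW]
    congr 1
    exact Module.card_eq_pow_finrank (K := F) (V := W)
  have := hS.le_finrank (X := (Finset.univ.filter fun v : Fin n → F => v ∈ W).erase 0) (W := W)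
    (fun v hv => hall v (Finset.ne_of_mem_erase hv)) (hcard ▸ hk)
    (fun v hv => (Finset.mem_filter.1 (Finset.mem_of_mem_erase (Finset.mem_coe.1 hv))).2)
  omega

theorem stmt19 (q : ℕ) (hq : IsPrimePow q) (F : Type*) [Field F] [Fintype F]
    (hF : Fintype.card F = q) (n k ℓ : ℕ)
    (hℓ : 2 ≤ ℓ) (hℓk : ℓ ≤ k) (hℓn : ℓ ≤ n)
    (hk : k ≤ (q ^ (ℓ - 1) - 1) / (q - 1)) :
    IndMax F n k ℓ = (q - 1) * ProIndMax F n k ℓ ↔ q = 2 := by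
  classical
  have hk0 : 0 < k := by omega
  constructor
  · intro heq
    by_contra hq2
    have hq3 : 3 ≤ Fintype.card F := by
      have := hq.two_le
      omega
    subst hF
    obtain ⟨S, hS, hSc⟩ := exists_indKL_card_eq_indMax F (n := n) ℓ hk0
    have hle := hS.card_le_mul_card_projImage
    have hT := hS.proIndKL_projImage.card_le_proIndMax
    have hTmax : ProIndMax F n k ℓ ≤ (projImage S).card := by
      rw [hSc, heq] at hle
      exact Nat.le_of_mul_le_mul_left hle (by omega)
    have hcone : S = projCone (projImage S) := by
      refine Finset.eq_of_subset_of_card_le hS.subset_projCone ?_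
      rw [card_projCone, hSc, heq]
      exact Nat.mul_le_mul_left _ hT
    obtain ⟨v, hv0, hvS⟩ := hS.exists_ne_zero_notMem (by omega) hℓn
      (hk.trans (Nat.div_le_self _ _))
    have hx : Projectivization.mk F v hv0 ∉ projImage S := fun h =>
      hvS (hcone ▸ mem_projCone.2 ⟨hv0, h⟩)
    have hins := (proIndKL_insert_of_indKL_projCone hq3 (by omega) (hcone ▸ hS)
      (Projectivization.mk F v hv0)).card_le_proIndMax
    rw [Finset.card_insert_of_notMem hx] at hins
    omega
  · rintro rfl
    have h1 := indMax_le_mul_proIndMax F (n := n) ℓ hk0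
    have h2 := proIndMax_le_indMax F (n := n) ℓ hk0
    rw [hF] at h1
    omega
end
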